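/- arXiv:2311.18425 — 8 statements merged into one kernel-verified Lean document; each statement's English description precedes it below -/
import Mathlib

section
/- Let A be a finite set, k ≥ 1 an integer, and f : 2^A → [0,1] a submodular set function with f(∅) = 0 and f({i}) = 1/k for every i ∈ A, and set costs c_i = 1/(2k²) for every i ∈ A. Then for every set T ⊆ A it holds that g(T) = (1 − Σ_{i∈T} c_i/(f(T) − f(T∖{i}))) · f(T) ≤ 1/2. -/
open Classical in
/-- The principal's utility `g(S) = (1 - ∑_{i ∈ S} c_i / (f(S) - f(S \ {i}))) · f(S)` in the
multi-agent contract model, valued in `EReal`, interpreted as `-∞` whenever some agent `i ∈ S`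
has positive cost `c i > 0` but zero marginal contribution `f(S) - f(S \ {i}) = 0`.
(When `c i = 0` and the marginal is `0`, the term `c i / 0 = 0`, matching the convention.) -/
noncomputable def principalUtility {ι : Type*} [DecidableEq ι]
    (f : Finset ι → ℝ) (c : ι → ℝ) (S : Finset ι) : EReal :=
  if ∃ i ∈ S, 0 < c i ∧ f S - f (S.erase i) = 0 then ⊥
  else (((1 - ∑ i ∈ S, c i / (f S - f (S.erase i))) * f S : ℝ) : EReal)

/-- Submodularity bounds the value of a set by the sum of the values of its elements. -/
theorem le_sum_singleton_of_submodular {ι : Type*} [DecidableEq ι] {f : Finset ι → ℝ}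
    (hsub : ∀ S S' : Finset ι, S ⊆ S' → ∀ i : ι,
      f (insert i S') - f S' ≤ f (insert i S) - f S)
    (hempty : f ∅ = 0) (T : Finset ι) : f T ≤ ∑ i ∈ T, f {i} := by
  induction T using Finset.induction_on with
  | empty => simp [hempty]
  | insert i S hi ih =>
    have h := hsub ∅ S (Finset.empty_subset S) i
    rw [insert_empty_eq, hempty] at h
    rw [Finset.sum_insert hi]
    linarith

theorem stmt3 {ι : Type*} [Fintype ι] [DecidableEq ι] (k : ℕ) (hk : 1 ≤ k)
    (f : Finset ι → ℝ)
    (hf01 : ∀ S : Finset ι, 0 ≤ f S ∧ f S ≤ 1)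
    (hsub : ∀ S S' : Finset ι, S ⊆ S' → ∀ i : ι,
      f (insert i S') - f S' ≤ f (insert i S) - f S)
    (hempty : f ∅ = 0)
    (hsingle : ∀ i : ι, f {i} = 1 / (k : ℝ)) :
    ∀ T : Finset ι,
      principalUtility f (fun _ => 1 / (2 * (k : ℝ) ^ 2)) T ≤ ((1 / 2 : ℝ) : EReal) := by
  intro T
  unfold principalUtility
  split_ifs with h
  · exact bot_le
  rw [EReal.coe_le_coe_iff]
  push Not at h
  have hk0 : (0 : ℝ) < k := by exact_mod_cast hk
  have hterm : ∀ i ∈ T,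
      1 / (2 * (k : ℝ)) ≤ 1 / (2 * (k : ℝ) ^ 2) / (f T - f (T.erase i)) := by
    intro i hi
    have hle := hsub ∅ (T.erase i) (Finset.empty_subset _) i
    rw [Finset.insert_erase hi, insert_empty_eq, hempty, hsingle, sub_zero] at hle
    -- The submodularity inequality also covers `i ∈ S'`, where it gives monotonicity.
    have hnonneg := hsub (T.erase i) T (Finset.erase_subset i T) i
    rw [Finset.insert_erase hi, Finset.insert_eq_of_mem hi, sub_self] at hnonneg
    have hpos : 0 < f T - f (T.erase i) :=
      lt_of_le_of_ne hnonneg (h i hi (by positivity)).symm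
    rw [le_div_iff₀ hpos]
    calc 1 / (2 * (k : ℝ)) * (f T - f (T.erase i)) ≤ 1 / (2 * (k : ℝ)) * (1 / k) := by gcongr
      _ = 1 / (2 * (k : ℝ) ^ 2) := by field_simp
  have hsum := Finset.sum_le_sum hterm
  have hfT := le_sum_singleton_of_submodular hsub hempty T
  simp only [hsingle] at hfT
  have hhalf : ∑ _i ∈ T, 1 / (2 * (k : ℝ)) = (∑ _i ∈ T, 1 / (k : ℝ)) / 2 := by
    rw [Finset.sum_div]
    exact Finset.sum_congr rfl fun _ _ => by field_simp
  obtain ⟨h0, -⟩ := hf01 T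
  calc _ ≤ (1 - f T / 2) * f T := mul_le_mul_of_nonneg_right (by linarith) h0
    _ ≤ 1 / 2 := by nlinarith [sq_nonneg (1 - f T)]
end

section
/- Let A be a finite set, k ≥ 1 an integer, and f : 2^A → [0,1] a submodular set function with f(∅) = 0 and f({i}) = 1/k for every i ∈ A, and set costs c_i = 1/(2k²) for every i ∈ A. Then every set S ⊆ A with |S| ≥ 2k satisfies g(S) = (1 − Σ_{i∈S} c_i/(f(S) − f(S∖{i}))) · f(S) ≤ 0. -/
theorem stmt4 {ι : Type*} [Fintype ι] [DecidableEq ι] (k : ℕ) (hk : 1 ≤ k)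
    (f : Finset ι → ℝ)
    (hf01 : ∀ S : Finset ι, 0 ≤ f S ∧ f S ≤ 1)
    (hsub : ∀ S S' : Finset ι, S ⊆ S' → ∀ i : ι,
      f (insert i S') - f S' ≤ f (insert i S) - f S)
    (hempty : f ∅ = 0)
    (hsingle : ∀ i : ι, f {i} = 1 / (k : ℝ)) :
    ∀ S : Finset ι, 2 * k ≤ S.card →
      principalUtility f (fun _ => 1 / (2 * (k : ℝ) ^ 2)) S ≤ (0 : EReal) := by
  intro S hS
  unfold principalUtility
  split_ifs with h
  · exact bot_le
  push Not at h
  have hk0 : (0 : ℝ) < k := by exact_mod_cast hk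
  have hterm : ∀ i ∈ S, 1 / (2 * (k : ℝ)) ≤ 1 / (2 * (k : ℝ) ^ 2) / (f S - f (S.erase i)) := by
    intro i hi
    -- submodularity with `i ∈ S` forces every marginal contribution to be nonnegative
    have h_nonneg := hsub (S.erase i) S (S.erase_subset i) i
    have h_le := hsub ∅ (S.erase i) (Finset.empty_subset _) i
    rw [Finset.insert_erase hi, Finset.insert_eq_of_mem hi, sub_self] at h_nonneg
    rw [Finset.insert_erase hi, insert_empty_eq, hsingle, hempty, sub_zero] at h_le
    have h_pos : 0 < f S - f (S.erase i) :=
      lt_of_le_of_ne h_nonneg (Ne.symm (h i hi (by positivity)))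
    rw [le_div_iff₀ h_pos]
    calc 1 / (2 * (k : ℝ)) * (f S - f (S.erase i)) ≤ 1 / (2 * (k : ℝ)) * (1 / k) := by gcongr
      _ = 1 / (2 * (k : ℝ) ^ 2) := by field_simp
  have hsum : 1 ≤ ∑ i ∈ S, 1 / (2 * (k : ℝ) ^ 2) / (f S - f (S.erase i)) := by
    have hcard : 2 * (k : ℝ) ≤ S.card := by exact_mod_cast hS
    calc (1 : ℝ) ≤ S.card * (1 / (2 * (k : ℝ))) := by
          rw [mul_one_div, one_le_div (by positivity)]
          exact hcard
      _ ≤ _ := by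
          rw [← nsmul_eq_mul]
          exact Finset.card_nsmul_le_sum _ _ _ hterm
  exact_mod_cast mul_nonpos_of_nonpos_of_nonneg (sub_nonpos.mpr hsum) (hf01 S).1
end

section
/- Let A be a finite set, k ≥ 1 an integer, and f : 2^A → [0,1] a submodular set function with f(∅) = 0 and f({i}) = 1/k for every i ∈ A, and set costs c_i = 1/(2k²) for every i ∈ A. Assume further that every set S ⊆ A with |S| ≤ 2k satisfies f(S) ≤ 1 − e^{−|S|/k} + 0.01. Then every set S ⊆ A satisfies g(S) = (1 − Σ_{i∈S} c_i/(f(S) − f(S∖{i}))) · f(S) < 0.35. -/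
/-- For a submodular set function, the marginals with respect to a set `S` of the elements of a
subset `T ⊆ S` sum to at most `f T - f ∅`. -/
theorem sum_marginal_le {ι : Type*} [DecidableEq ι] {f : Finset ι → ℝ}
    (hsub : ∀ S S' : Finset ι, S ⊆ S' → ∀ i : ι,
      f (insert i S') - f S' ≤ f (insert i S) - f S)
    {S T : Finset ι} (hT : T ⊆ S) :
    ∑ i ∈ T, (f S - f (S.erase i)) ≤ f T - f ∅ := by
  induction T using Finset.induction_on with
  | empty => simp
  | insert a T ha ih =>
    obtain ⟨haS, hTS⟩ := Finset.insert_subset_iff.mp hT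
    have h := hsub T (S.erase a) (Finset.subset_erase.mpr ⟨hTS, ha⟩) a
    rw [Finset.insert_erase haS] at h
    rw [Finset.sum_insert ha]
    linarith [ih hTS]

/-- A weak quadratic lower bound for `exp (-x)`, from squaring `1 - x / 2 ≤ exp (-x / 2)`. -/
theorem one_sub_half_sq_le_exp_neg {x : ℝ} (hx : x ≤ 2) : (1 - x / 2) ^ 2 ≤ Real.exp (-x) := by
  have h : 1 - x / 2 ≤ Real.exp (-(x / 2)) := Real.one_sub_le_exp_neg (x / 2)
  calc (1 - x / 2) ^ 2 ≤ Real.exp (-(x / 2)) ^ 2 := by gcongr; linarith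
    _ = Real.exp (-x) := by rw [← Real.exp_nat_mul]; congr 1; push_cast; ring

/-- Cauchy-Schwarz for reciprocals, against any upper bound of the sum. -/
theorem card_sq_le_sum_inv_mul {ι : Type*} {s : Finset ι} {m : ι → ℝ} {b : ℝ}
    (hm : ∀ i ∈ s, 0 < m i) (hb : ∑ i ∈ s, m i ≤ b) :
    (s.card : ℝ) ^ 2 ≤ (∑ i ∈ s, 1 / m i) * b := by
  have h := Finset.sum_sq_le_sum_mul_sum_of_sq_le_mul s (r := fun _ => (1 : ℝ))
    (f := fun i => 1 / m i) (g := m) (fun i hi => (one_div_pos.mpr (hm i hi)).le)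
    (fun i hi => (hm i hi).le) (fun i hi => by simp [(hm i hi).ne'])
  have h0 : 0 ≤ ∑ i ∈ s, 1 / m i := Finset.sum_nonneg fun i hi => (one_div_pos.mpr (hm i hi)).le
  calc (s.card : ℝ) ^ 2 = (∑ _i ∈ s, (1 : ℝ)) ^ 2 := by simp
    _ ≤ (∑ i ∈ s, 1 / m i) * ∑ i ∈ s, m i := h
    _ ≤ _ := by gcongr

theorem stmt5 {ι : Type*} [Fintype ι] [DecidableEq ι] (k : ℕ) (hk : 1 ≤ k)
    (f : Finset ι → ℝ)
    (hf01 : ∀ S : Finset ι, 0 ≤ f S ∧ f S ≤ 1)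
    (hsub : ∀ S S' : Finset ι, S ⊆ S' → ∀ i : ι,
      f (insert i S') - f S' ≤ f (insert i S) - f S)
    (hempty : f ∅ = 0)
    (hsingle : ∀ i : ι, f {i} = 1 / (k : ℝ))
    (hsmall : ∀ S : Finset ι, S.card ≤ 2 * k →
      f S ≤ 1 - Real.exp (-(S.card : ℝ) / (k : ℝ)) + 0.01) :
    ∀ S : Finset ι,
      principalUtility f (fun _ => 1 / (2 * (k : ℝ) ^ 2)) S < ((0.35 : ℝ) : EReal) := by
  intro S
  have hk0 : (0 : ℝ) < k := by exact_mod_cast hk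
  unfold principalUtility
  split_ifs with hS
  · exact EReal.bot_lt_coe _
  rw [EReal.coe_lt_coe_iff]
  push Not at hS
  have hpos : ∀ i ∈ S, 0 < f S - f (S.erase i) := by
    intro i hi
    have h := hsub (S.erase i) S (S.erase_subset i) i
    rw [Finset.insert_erase hi, Finset.insert_eq_of_mem hi, sub_self] at h
    exact lt_of_le_of_ne h (hS i hi (by positivity)).symm
  have hsum : ∑ i ∈ S, (f S - f (S.erase i)) ≤ f S := by
    simpa [hempty] using sum_marginal_le hsub (Finset.Subset.refl S)
  have hcs := card_sq_le_sum_inv_mul hpos hsum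
  obtain ⟨x, hx⟩ : ∃ x : ℝ, x = S.card / k := ⟨_, rfl⟩
  have hg : (1 - ∑ i ∈ S, 1 / (2 * (k : ℝ) ^ 2) / (f S - f (S.erase i))) * f S
      ≤ f S - x ^ 2 / 2 := by
    have hfac : ∑ i ∈ S, 1 / (2 * (k : ℝ) ^ 2) / (f S - f (S.erase i))
        = 1 / (2 * (k : ℝ) ^ 2) * ∑ i ∈ S, 1 / (f S - f (S.erase i)) := by
      rw [Finset.mul_sum]
      exact Finset.sum_congr rfl fun i _ => by ring
    have hx2 : x ^ 2 / 2 = 1 / (2 * (k : ℝ) ^ 2) * (S.card : ℝ) ^ 2 := by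
      rw [hx]; field_simp
    have := mul_le_mul_of_nonneg_left hcs (by positivity : 0 ≤ 1 / (2 * (k : ℝ) ^ 2))
    rw [hfac, hx2]
    linarith
  refine hg.trans_lt ?_
  rcases le_or_gt S.card (2 * k) with hcard | hcard
  · have hx2 : x ≤ 2 := by
      rw [hx, div_le_iff₀ hk0]; exact_mod_cast hcard
    have hf := hsmall S hcard
    rw [neg_div, ← hx] at hf
    nlinarith [one_sub_half_sq_le_exp_neg hx2, sq_nonneg (x - 2 / 3)]
  · have hx2 : 2 < x := by
      rw [hx, lt_div_iff₀ hk0]; exact_mod_cast hcard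
    nlinarith [(hf01 S).2]
end

section
/- For every real number x ≥ 0 it holds that (1 − x/2)·(1 − e^{−x} + 0.01) < 0.35. -/
theorem exp_neg_four_fifths_gt : (0.44 : ℝ) < Real.exp (-0.8) := by
  have h : (0.95 : ℝ) ≤ Real.exp (-0.05) := by
    linarith [Real.add_one_le_exp (-0.05 : ℝ)]
  calc (0.44 : ℝ) < 0.95 ^ 16 := by norm_num
    _ ≤ Real.exp (-0.05) ^ 16 := by gcongr
    _ = Real.exp (-0.8) := by rw [← Real.exp_nat_mul]; norm_num

theorem stmt6 (x : ℝ) (hx : 0 ≤ x) :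
    (1 - x / 2) * (1 - Real.exp (-x) + 0.01) < 0.35 := by
  have hpos := Real.exp_pos (-x)
  rcases le_total x 1.8 with h | h
  · have htangent : 0.44 * (1.8 - x) ≤ Real.exp (-x) := by
      calc 0.44 * (1.8 - x) ≤ Real.exp (-0.8) * Real.exp (0.8 - x) := by
            gcongr
            · exact exp_neg_four_fifths_gt.le
            · linarith [Real.add_one_le_exp (0.8 - x)]
        _ = Real.exp (-x) := by rw [← Real.exp_add]; ring_nf
    have hfactor : 0 ≤ 1 - x / 2 := by linarith
    nlinarith [mul_le_mul_of_nonneg_left htangent hfactor, sq_nonneg (x - 0.75)]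
  · have hle : Real.exp (-x) ≤ 1 := Real.exp_le_one_iff.mpr (by linarith)
    nlinarith
end

section
/- Let β be a real number with 0 < β < 1/12 and let x be a real number with 0 ≤ x ≤ 2. If (1 − β²)·x ≤ 1 − e^{−x} + β⁴, then x < 6β². -/
theorem stmt8 (β x : ℝ) (hβ0 : 0 < β) (hβ1 : β < 1 / 12)
    (hx0 : 0 ≤ x) (hx2 : x ≤ 2)
    (h : (1 - β ^ 2) * x ≤ 1 - Real.exp (-x) + β ^ 4) :
    x < 6 * β ^ 2 := by
  have hexp : (1 - x / 2) ^ 2 ≤ Real.exp (-x) := by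
    have hhalf : 1 - x / 2 ≤ Real.exp (-(x / 2)) := Real.one_sub_le_exp_neg _
    calc (1 - x / 2) ^ 2 ≤ Real.exp (-(x / 2)) ^ 2 :=
          pow_le_pow_left₀ (by linarith) hhalf 2
      _ = Real.exp (-x) := by
          rw [← Real.exp_nat_mul]
          congr 1
          push_cast
          ring
  by_contra! hx
  have hb : 0 < β ^ 2 := by positivity
  have hquad : x ^ 2 / 4 ≤ β ^ 2 * x + (β ^ 2) ^ 2 := by linarith
  nlinarith [mul_nonneg (sub_nonneg.2 hx) hx0, mul_nonneg (sub_nonneg.2 hx) hb.le, mul_pos hb hb]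
end

section
/- Let G' = (V', E') be a finite simple graph, let δ be a positive integer, let ε > 0, and set M = |V'| + ε. Define f : 2^{V'} → ℝ≥0 by f(S) = (M + 1[S is a clique in G'])·|S| + min(|S|, δ)·ε. Then f is monotone (S ⊆ S' implies f(S) ≤ f(S')), and for every S ⊆ V', f(S) = max over nonempty T ⊆ V' of Σ_{i∈S} a_i^T, where a_i^T = M + 1[T is a clique in G'] + ε·min(|T|, δ)/|T| if i ∈ T and a_i^T = 0 otherwise; in particular f is XOS. -/
open Classical in
/-- The success probability function
`f(S) = (M + 1[S is a clique in G]) · |S| + min(|S|, δ) · ε`. -/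
noncomputable def cliqueF {V' : Type*} (G : SimpleGraph V') (M : ℝ) (δ : ℕ) (ε : ℝ)
    (S : Finset V') : ℝ :=
  (M + (if G.IsClique (S : Set V') then (1 : ℝ) else 0)) * S.card + ((min S.card δ : ℕ) : ℝ) * ε

open Classical in
/-- The additive weights `a_i^T` witnessing that `cliqueF` is XOS:
`a_i^T = M + 1[T is a clique] + ε · min(|T|, δ)/|T|` if `i ∈ T`, and `0` otherwise. -/
noncomputable def cliqueA {V' : Type*} (G : SimpleGraph V') (M : ℝ) (δ : ℕ) (ε : ℝ)
    (T : Finset V') (i : V') : ℝ :=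
  if i ∈ T then
    M + (if G.IsClique (T : Set V') then (1 : ℝ) else 0) + ε * ((min T.card δ : ℕ) : ℝ) / T.card
  else 0

theorem cliqueF_mono {V' : Type*} [Fintype V'] (G : SimpleGraph V') (δ : ℕ) {ε M : ℝ}
    (hε : 0 ≤ ε) (hM : (Fintype.card V' : ℝ) ≤ M) : Monotone (cliqueF G M δ ε) := by
  classical
  intro S S' h
  rcases h.eq_or_ssubset with rfl | hlt
  · exact le_rfl
  have hcard : (S.card : ℝ) + 1 ≤ S'.card := by exact_mod_cast Finset.card_lt_card hlt
  have hSV : (S.card : ℝ) ≤ Fintype.card V' := by exact_mod_cast Finset.card_le_univ S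
  have hM0 : 0 ≤ M := (Nat.cast_nonneg _).trans hM
  have hmin : ((min S.card δ : ℕ) : ℝ) * ε ≤ ((min S'.card δ : ℕ) : ℝ) * ε := by
    gcongr
  have hS : (if G.IsClique (S : Set V') then (1 : ℝ) else 0) ≤ 1 := by split_ifs <;> norm_num
  have hS' : (0 : ℝ) ≤ if G.IsClique (S' : Set V') then 1 else 0 := by split_ifs <;> norm_num
  have hmain : (M + (if G.IsClique (S : Set V') then (1 : ℝ) else 0)) * S.card ≤
      (M + (if G.IsClique (S' : Set V') then (1 : ℝ) else 0)) * S'.card :=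
    calc
      _ ≤ (M + 1) * S.card := by gcongr
      _ ≤ M * (S.card + 1) := by linarith
      _ ≤ M * S'.card := by gcongr
      _ ≤ _ := by gcongr; linarith
  exact add_le_add hmain hmin

open Classical in
theorem sum_cliqueA {V' : Type*} (G : SimpleGraph V') (M : ℝ) (δ : ℕ) (ε : ℝ)
    (S T : Finset V') :
    ∑ i ∈ S, cliqueA G M δ ε T i = (S ∩ T).card *
      (M + (if G.IsClique (T : Set V') then (1 : ℝ) else 0) +
        ε * ((min T.card δ : ℕ) : ℝ) / T.card) := by
  simp only [cliqueA, Finset.sum_ite_mem, Finset.sum_const, nsmul_eq_mul]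

theorem sum_cliqueA_self {V' : Type*} (G : SimpleGraph V') (M : ℝ) (δ : ℕ) (ε : ℝ)
    {S : Finset V'} (hS : S.Nonempty) :
    ∑ i ∈ S, cliqueA G M δ ε S i = cliqueF G M δ ε S := by
  classical
  have : (S.card : ℝ) ≠ 0 := by exact_mod_cast hS.card_pos.ne'
  rw [sum_cliqueA, Finset.inter_self, cliqueF]
  field_simp

theorem card_mul_min_div_card_le {α : Type*} {R T : Finset α} (h : R ⊆ T) (δ : ℕ) :
    (R.card : ℝ) * (((min T.card δ : ℕ) : ℝ) / T.card) ≤ ((min R.card δ : ℕ) : ℝ) := by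
  have hRT : (R.card : ℝ) ≤ T.card := by exact_mod_cast Finset.card_le_card h
  rw [Nat.cast_min, Nat.cast_min]
  refine le_min ?_ ?_
  · exact mul_le_of_le_one_right (Nat.cast_nonneg _)
      (div_le_one_of_le₀ (min_le_left _ _) (Nat.cast_nonneg _))
  · rw [← mul_div_assoc]
    refine div_le_of_le_mul₀ (Nat.cast_nonneg _) (Nat.cast_nonneg _) ?_
    rw [mul_comm (δ : ℝ)]
    gcongr
    exact min_le_right _ _

theorem exists_subset_sum_cliqueA_le_cliqueF {V' : Type*} (G : SimpleGraph V') (M : ℝ)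
    (δ : ℕ) {ε : ℝ} (hε : 0 ≤ ε) (S T : Finset V') :
    ∃ R ⊆ S, ∑ i ∈ S, cliqueA G M δ ε T i ≤ cliqueF G M δ ε R := by
  classical
  refine ⟨S ∩ T, Finset.inter_subset_left, ?_⟩
  have hind : (if G.IsClique (T : Set V') then (1 : ℝ) else 0) ≤
      if G.IsClique ((S ∩ T : Finset V') : Set V') then 1 else 0 := by
    by_cases hT : G.IsClique (T : Set V')
    · have hR : G.IsClique ((S ∩ T : Finset V') : Set V') :=
        hT.subset (Finset.coe_subset.2 Finset.inter_subset_right)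
      rw [if_pos hT, if_pos hR]
    · rw [if_neg hT]
      split_ifs <;> norm_num
  have hmin := mul_le_mul_of_nonneg_left
    (card_mul_min_div_card_le (Finset.inter_subset_right : S ∩ T ⊆ T) δ) hε
  have hcl := mul_le_mul_of_nonneg_left hind (Nat.cast_nonneg (α := ℝ) (S ∩ T).card)
  have hsum := sum_cliqueA G M δ ε S T
  rw [mul_add, mul_add, mul_div_assoc, mul_left_comm _ ε] at hsum
  unfold cliqueF
  linarith

theorem stmt11 {V' : Type*} [Fintype V'] [DecidableEq V'] [Nonempty V'] (G : SimpleGraph V')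
    (δ : ℕ) (hδ : 0 < δ) (ε : ℝ) (hε : 0 < ε)
    (M : ℝ) (hM : M = (Fintype.card V' : ℝ) + ε) :
    (∀ S S' : Finset V', S ⊆ S' → cliqueF G M δ ε S ≤ cliqueF G M δ ε S') ∧
    (∀ S : Finset V',
      (∀ T : Finset V', T.Nonempty → ∑ i ∈ S, cliqueA G M δ ε T i ≤ cliqueF G M δ ε S) ∧
      (∃ T : Finset V', T.Nonempty ∧ cliqueF G M δ ε S = ∑ i ∈ S, cliqueA G M δ ε T i)) := by
  have hmono : Monotone (cliqueF G M δ ε) := cliqueF_mono G δ hε.le (by linarith)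
  refine ⟨fun S S' h => hmono h, fun S => ⟨fun T _ => ?_, ?_⟩⟩
  · obtain ⟨R, hRS, hR⟩ := exists_subset_sum_cliqueA_le_cliqueF G M δ hε.le S T
    exact hR.trans (hmono hRS)
  · rcases S.eq_empty_or_nonempty with rfl | hS
    · exact ⟨Finset.univ, Finset.univ_nonempty, by simp [cliqueF]⟩
    · exact ⟨S, hS, (sum_cliqueA_self G M δ ε hS).symm⟩
end

section
/- Let m ≥ 4 be an integer, n = m³, A = {1,...,n}, and let G ⊆ A with |G| = m. Define f_G : 2^A → [0,1] by f_G(∅) = 0 and f_G(S) = (1/n)·max(|S ∩ G|, √m, |S|/√m) for nonempty S, and set costs c_i = 1/(2mn) for every i ∈ A. Then every set S ⊆ A satisfying |S| > m^{3/2} or |S ∩ G| ≤ √m satisfies g(S) = (1 − Σ_{i∈S} c_i/(f_G(S) − f_G(S∖{i}))) · f_G(S) ≤ 2√m/n = (4/√m)·(m/(2n)). -/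
/-- The success probability function
`f_G(S) = (1/n) · max(|S ∩ G|, √m, |S|/√m)` for nonempty `S`, and `f_G(∅) = 0`. -/
noncomputable def fG (m n : ℕ) (G : Finset (Fin n)) (S : Finset (Fin n)) : ℝ :=
  if S = ∅ then 0
  else (1 / (n : ℝ)) *
    max (max ((S ∩ G).card : ℝ) (Real.sqrt m)) ((S.card : ℝ) / Real.sqrt m)

theorem fG_nonneg (m n : ℕ) (G S : Finset (Fin n)) : 0 ≤ fG m n G S := by
  unfold fG
  split_ifs <;> positivity

theorem fG_mono (m n : ℕ) (G : Finset (Fin n)) : Monotone (fG m n G) := by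
  intro T S hTS
  by_cases hT : T = ∅
  · rw [show fG m n G T = 0 from if_pos hT]
    exact fG_nonneg m n G S
  · have hS : S ≠ ∅ := by
      rintro rfl
      exact hT (Finset.subset_empty.mp hTS)
    unfold fG
    rw [if_neg hT, if_neg hS]
    have h₁ : ((T ∩ G).card : ℝ) ≤ (S ∩ G).card := by
      exact_mod_cast Finset.card_le_card (Finset.inter_subset_inter_right hTS)
    have h₂ : (T.card : ℝ) ≤ S.card := by exact_mod_cast Finset.card_le_card hTS
    gcongr

theorem card_div_sqrt_le_fG (m n : ℕ) (G S : Finset (Fin n)) :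
    1 / (n : ℝ) * ((S.card : ℝ) / √m) ≤ fG m n G S := by
  unfold fG
  split_ifs with h
  · simp [h]
  · gcongr
    exact le_max_right _ _

/-- When the term `|S| / √m` dominates, every marginal contribution is at most `1 / (n √m)`. -/
theorem fG_sub_erase_le {m n : ℕ} {G S : Finset (Fin n)}
    (hG : ((S ∩ G).card : ℝ) ≤ S.card / √m) (hm : √m ≤ S.card / √m) {i : Fin n} (hi : i ∈ S) :
    fG m n G S - fG m n G (S.erase i) ≤ 1 / (n : ℝ) * (1 / √m) := by
  have h := card_div_sqrt_le_fG m n G (S.erase i)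
  have hS : fG m n G S = 1 / (n : ℝ) * ((S.card : ℝ) / √m) := by
    rw [fG, if_neg (Finset.ne_empty_of_mem hi), max_eq_right (max_le hG hm)]
  rw [Finset.cast_card_erase_of_mem hi, sub_div, mul_sub] at h
  linarith

theorem principalUtility_le {ι : Type*} [DecidableEq ι] {f : Finset ι → ℝ} {c : ι → ℝ}
    {S : Finset ι} {b : ℝ}
    (h : (∀ i ∈ S, 0 < c i → f S - f (S.erase i) ≠ 0) →
      (1 - ∑ i ∈ S, c i / (f S - f (S.erase i))) * f S ≤ b) :
    principalUtility f c S ≤ (b : EReal) := by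
  unfold principalUtility
  split_ifs with hbot
  · exact bot_le
  · exact EReal.coe_le_coe_iff.mpr (h fun i hi hc h₀ => hbot ⟨i, hi, hc, h₀⟩)

theorem stmt16 (m n : ℕ) (hm : 4 ≤ m) (hn : n = m ^ 3)
    (G : Finset (Fin n)) (hG : G.card = m) :
    ∀ S : Finset (Fin n),
      ((m : ℝ) * Real.sqrt m < (S.card : ℝ) ∨ ((S ∩ G).card : ℝ) ≤ Real.sqrt m) →
      principalUtility (fG m n G) (fun _ => 1 / (2 * (m : ℝ) * (n : ℝ))) S
        ≤ ((2 * Real.sqrt m / (n : ℝ) : ℝ) : EReal) := by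
  intro S hS
  have hm' : (4 : ℝ) ≤ m := by exact_mod_cast hm
  have hn' : (0 : ℝ) < n := by
    have : 0 < n := hn ▸ pow_pos (by omega) 3
    exact_mod_cast this
  have hr : (2 : ℝ) ≤ √m := Real.le_sqrt_of_sq_le (by linarith)
  have hrr : √(m : ℝ) * √m = m := Real.mul_self_sqrt (by linarith)
  have hk : ((S ∩ G).card : ℝ) ≤ m := by
    exact_mod_cast hG ▸ Finset.card_le_card Finset.inter_subset_right
  have hr₀ : (0 : ℝ) < √m := by linarith
  refine principalUtility_le fun hne => ?_
  have hpos : ∀ i ∈ S, 0 < fG m n G S - fG m n G (S.erase i) := fun i hi =>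
    lt_of_le_of_ne (sub_nonneg.mpr (fG_mono m n G (S.erase_subset i)))
      (hne i hi (by positivity)).symm
  by_cases hs : 2 * (m : ℝ) < S.card
  · have hms : √(m : ℝ) ≤ S.card / √m := by
      rw [le_div_iff₀ hr₀]
      linarith
    have hks : ((S ∩ G).card : ℝ) ≤ S.card / √m := by
      rcases hS with h | h
      · exact hk.trans ((le_div_iff₀ hr₀).mpr h.le)
      · exact h.trans hms
    have hterm : ∀ i ∈ S, √(m : ℝ) / (2 * m) ≤
        1 / (2 * (m : ℝ) * n) / (fG m n G S - fG m n G (S.erase i)) := by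
      intro i hi
      calc √(m : ℝ) / (2 * m) = 1 / (2 * (m : ℝ) * n) / (1 / (n : ℝ) * (1 / √m)) := by
            field_simp
        _ ≤ _ := div_le_div_of_nonneg_left (by positivity) (hpos i hi)
            (fG_sub_erase_le hks hms hi)
    have hsum := Finset.card_nsmul_le_sum S _ _ hterm
    rw [nsmul_eq_mul] at hsum
    have hone : 1 ≤ (S.card : ℝ) * (√m / (2 * m)) := by
      rw [← mul_div_assoc, le_div_iff₀ (by positivity)]
      nlinarith
    exact (mul_nonpos_of_nonpos_of_nonneg (by linarith) (fG_nonneg m n G S)).trans (by positivity)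
  · rw [not_lt] at hs
    have hk' : ((S ∩ G).card : ℝ) ≤ √m := hS.resolve_left (by nlinarith)
    have hsum : 0 ≤ ∑ i ∈ S,
        1 / (2 * (m : ℝ) * n) / (fG m n G S - fG m n G (S.erase i)) :=
      Finset.sum_nonneg fun i hi => div_nonneg (by positivity) (hpos i hi).le
    have hf : fG m n G S ≤ 2 * √m / n := by
      unfold fG
      split_ifs
      · positivity
      · rw [one_div_mul_eq_div]
        gcongr
        refine max_le (max_le (by linarith) (by linarith)) ?_
        rw [div_le_iff₀ hr₀]
        linarith
    exact (mul_le_of_le_one_left (fG_nonneg m n G S) (by linarith)).trans hf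
end

section
/- Let A be a finite set and let f : 2^A → ℝ≥0 be a submodular set function with f(∅) = 0. Then for every S ⊆ A and every integer k with 0 ≤ k ≤ |S|, there exists a subset S' ⊆ S with |S'| = k and f(S') ≥ (k/|S|)·f(S) (where for S = ∅ the claim is trivial). -/
/-- For a submodular function with nonnegative value at `∅`, the marginal contributions of the
elements of `T ⊆ S` to `S` add up to at most `f T`. -/
theorem sum_marginal_le_of_submodular {ι : Type*} [DecidableEq ι] {f : Finset ι → ℝ}
    (hempty : 0 ≤ f ∅)
    (hsub : ∀ S S' : Finset ι, S ⊆ S' → ∀ i ∉ S',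
      f (insert i S') - f S' ≤ f (insert i S) - f S) (S : Finset ι) :
    ∀ T ⊆ S, ∑ i ∈ T, (f S - f (S.erase i)) ≤ f T := by
  intro T
  induction T using Finset.induction_on with
  | empty => simpa using hempty
  | insert a T ha ih =>
    intro hT
    have haS : a ∈ S := hT (Finset.mem_insert_self a T)
    have hTS : T ⊆ S := (Finset.subset_insert a T).trans hT
    have h := hsub T (S.erase a) (Finset.subset_erase.2 ⟨hTS, ha⟩) a (Finset.notMem_erase a S)
    rw [Finset.insert_erase haS] at h
    rw [Finset.sum_insert ha]
    linarith [ih hTS]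

/-- Some element of a nonempty set `S` has marginal contribution at most the average
`f S / S.card`. -/
theorem exists_card_mul_marginal_le_of_submodular {ι : Type*} [DecidableEq ι]
    {f : Finset ι → ℝ} (hempty : 0 ≤ f ∅)
    (hsub : ∀ S S' : Finset ι, S ⊆ S' → ∀ i ∉ S',
      f (insert i S') - f S' ≤ f (insert i S) - f S) {S : Finset ι} (hS : S.Nonempty) :
    ∃ i ∈ S, (S.card : ℝ) * (f S - f (S.erase i)) ≤ f S := by
  obtain ⟨i, hi, hmin⟩ := S.exists_min_image (fun i => f S - f (S.erase i)) hS
  refine ⟨i, hi, le_trans ?_ (sum_marginal_le_of_submodular hempty hsub S S subset_rfl)⟩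
  simpa only [nsmul_eq_mul] using Finset.card_nsmul_le_sum S _ _ hmin

/-- Subset extraction for nonnegative submodular functions, with denominators cleared. -/
theorem exists_subset_card_eq_mul_le_of_submodular {ι : Type*} [DecidableEq ι]
    {f : Finset ι → ℝ} (hf0 : ∀ S : Finset ι, 0 ≤ f S)
    (hsub : ∀ S S' : Finset ι, S ⊆ S' → ∀ i ∉ S',
      f (insert i S') - f S' ≤ f (insert i S) - f S) (k d : ℕ) :
    ∀ S : Finset ι, S.card = k + d →
      ∃ S' ⊆ S, S'.card = k ∧ (k : ℝ) * f S ≤ (S.card : ℝ) * f S' := by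
  induction d with
  | zero => exact fun S hS => ⟨S, subset_rfl, hS, by rw [hS, add_zero]⟩
  | succ d ih =>
    intro S hS
    have hne : S.Nonempty := Finset.card_pos.1 (by omega)
    obtain ⟨i, hi, hle⟩ := exists_card_mul_marginal_le_of_submodular (hf0 ∅) hsub hne
    have hcard : (S.erase i).card = k + d := by
      rw [Finset.card_erase_of_mem hi, hS]
      omega
    obtain ⟨S', hS', hk, h⟩ := ih (S.erase i) hcard
    refine ⟨S', hS'.trans (Finset.erase_subset i S), hk, ?_⟩
    rcases Nat.eq_zero_or_pos k with rfl | hkpos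
    · simpa using mul_nonneg (Nat.cast_nonneg (α := ℝ) S.card) (hf0 S')
    · have hn : (S.card : ℝ) = ((k + d : ℕ) : ℝ) + 1 := by
        rw [hS]
        push_cast
        ring
      have hpos : (0 : ℝ) < ((k + d : ℕ) : ℝ) := by exact_mod_cast Nat.add_pos_left hkpos d
      rw [hcard] at h
      rw [hn] at hle ⊢
      refine le_of_mul_le_mul_left ?_ hpos
      have h₁ := mul_le_mul_of_nonneg_left hle (Nat.cast_nonneg (α := ℝ) k)
      have h₂ := mul_le_mul_of_nonneg_left h (add_pos hpos one_pos).le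
      linarith

theorem stmt18 {ι : Type*} [Fintype ι] [DecidableEq ι]
    (f : Finset ι → ℝ) (hf0 : ∀ S : Finset ι, 0 ≤ f S)
    (hsub : ∀ S S' : Finset ι, S ⊆ S' → ∀ i : ι,
      f (insert i S') - f S' ≤ f (insert i S) - f S)
    (hempty : f ∅ = 0) :
    ∀ S : Finset ι, ∀ k : ℕ, k ≤ S.card →
      ∃ S' ⊆ S, S'.card = k ∧ ((k : ℝ) / (S.card : ℝ)) * f S ≤ f S' := by
  intro S k hk
  obtain ⟨S', hS', hcard, h⟩ := exists_subset_card_eq_mul_le_of_submodular hf0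
    (fun S S' hSS' i _ => hsub S S' hSS' i) k (S.card - k) S (by omega)
  refine ⟨S', hS', hcard, ?_⟩
  rw [div_mul_eq_mul_div]
  exact div_le_of_le_mul₀ (Nat.cast_nonneg _) (hf0 S') (by rwa [mul_comm (f S')])
end
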